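/- Let v : ℝ → Matrix (Fin n) (Fin m) ℂ be smooth with v(x)ᴴ v(x) = 1 for all x, let A(x) = v(x)ᴴ v'(x), let P solve P'(x) = −A(x) P(x), P(x₀) = 1, and let Ω(b,a) = P(b) P(a)⁻¹. Let p(x) = v(x) v(x)ᴴ and for a smooth function w : ℝ → (Fin n → ℂ) define (Dw)(x) = p(x) · w'(x). Let z : ℝ → (Fin n → ℂ) be smooth with p(x) · z(x) = z(x) for all x (a section of the subbundle). Then for every fixed x ∈ ℝ, as h → 0, v(x) · Ω(x, x−h) · v(x−h)ᴴ · z(x−h) = z(x) − h (Dz)(x) + (h²/2) (D²z)(x) − (h³/6) (D³z)(x) + (h⁴/24) (D⁴z)(x) + O(h⁵). -/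

import Mathlib

open Matrix Filter Asymptotics

attribute [local instance] Matrix.normedAddCommGroup Matrix.normedSpace

/-- The operator `D = p ∘ d` acting on vector-valued functions, where `p(x) = v(x) v(x)ᴴ` is
the orthogonal projection onto the fibre of the subbundle spanned by the columns of `v`:
`(Dw)(x) = p(x) w'(x)`. -/
noncomputable def Dop {n m : ℕ} (v : ℝ → Matrix (Fin n) (Fin m) ℂ)
    (w : ℝ → Fin n → ℂ) : ℝ → Fin n → ℂ :=
  fun x => (v x * (v x)ᴴ) *ᵥ deriv w x

section Calculus

variable {m n l : Type*} [Fintype n]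

theorem hasDerivAt_matrix [Fintype m] {M : ℝ → Matrix m n ℂ} {M' : Matrix m n ℂ} {t : ℝ} :
    HasDerivAt M M' t ↔ ∀ i j, HasDerivAt (fun s => M s i j) (M' i j) t :=
  hasDerivAt_pi.trans (forall_congr' fun _ => hasDerivAt_pi)

theorem contDiff_matrix [Fintype m] {M : ℝ → Matrix m n ℂ} {k : WithTop ℕ∞} :
    ContDiff ℝ k M ↔ ∀ i j, ContDiff ℝ k fun s => M s i j :=
  contDiff_pi.trans (forall_congr' fun _ => contDiff_pi)

theorem HasDerivAt.matrix_mul [Fintype m] [Fintype l] {M : ℝ → Matrix m n ℂ} {N : ℝ → Matrix n l ℂ}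
    {M' : Matrix m n ℂ} {N' : Matrix n l ℂ} {t : ℝ}
    (hM : HasDerivAt M M' t) (hN : HasDerivAt N N' t) :
    HasDerivAt (fun s => M s * N s) (M' * N t + M t * N') t := by
  rw [hasDerivAt_matrix] at hM hN ⊢
  intro i j
  simp only [Matrix.mul_apply, Matrix.add_apply, ← Finset.sum_add_distrib]
  exact HasDerivAt.fun_sum fun k _ => (hM i k).mul (hN k j)

theorem HasDerivAt.matrix_mulVec [Fintype m] {M : ℝ → Matrix m n ℂ} {w : ℝ → n → ℂ}
    {M' : Matrix m n ℂ} {w' : n → ℂ} {t : ℝ}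
    (hM : HasDerivAt M M' t) (hw : HasDerivAt w w' t) :
    HasDerivAt (fun s => M s *ᵥ w s) (M' *ᵥ w t + M t *ᵥ w') t := by
  rw [hasDerivAt_matrix] at hM
  rw [hasDerivAt_pi] at hw ⊢
  intro i
  simp only [Matrix.mulVec, dotProduct, Pi.add_apply, ← Finset.sum_add_distrib]
  exact HasDerivAt.fun_sum fun k _ => (hM i k).mul (hw k)

theorem HasDerivAt.matrix_conjTranspose [Fintype m] {M : ℝ → Matrix m n ℂ} {M' : Matrix m n ℂ} {t : ℝ}
    (hM : HasDerivAt M M' t) : HasDerivAt (fun s => (M s)ᴴ) M'ᴴ t := by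
  rw [hasDerivAt_matrix] at hM ⊢
  exact fun i j => (hM j i).star

theorem ContDiff.matrix_mul_conjTranspose_mulVec [Fintype m] {M : ℝ → Matrix m n ℂ} {w : ℝ → m → ℂ}
    {k : WithTop ℕ∞} (hM : ContDiff ℝ k M) (hw : ContDiff ℝ k w) :
    ContDiff ℝ k fun s => (M s * (M s)ᴴ) *ᵥ w s := by
  rw [contDiff_matrix] at hM
  rw [contDiff_pi] at hw ⊢
  intro i
  simp only [Matrix.mulVec, dotProduct, Matrix.mul_apply, Matrix.conjTranspose_apply]
  exact ContDiff.sum fun a _ => (ContDiff.sum fun b _ =>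
    (hM i b).mul ((starL' ℝ (A := ℂ)).contDiff.comp (hM a b))).mul (hw a)

/-- Taylor expansion with remainder `O(h⁵)` of a function given with its chain of derivatives. -/
theorem isBigO_taylor_four_of_hasDerivAt {E : Type*} [NormedAddCommGroup E] [NormedSpace ℝ E]
    {g : ℕ → ℝ → E} (hg : ∀ k t, HasDerivAt (g k) (g (k + 1) t) t) (x : ℝ) :
    (fun h : ℝ => g 0 (x - h) - (g 0 x - h • g 1 x + (h ^ 2 / 2) • g 2 x
      - (h ^ 3 / 6) • g 3 x + (h ^ 4 / 24) • g 4 x)) =O[nhds 0] fun h : ℝ => h ^ 5 := by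
  have hiter : ∀ k, iteratedDeriv k (g 0) = g k := by
    intro k
    induction k with
    | zero => exact iteratedDeriv_zero
    | succ k ih =>
      rw [iteratedDeriv_succ, ih]
      exact funext fun t => (hg k t).deriv
  have hsmooth : ContDiff ℝ (5 : ℕ) (g 0) := by
    refine contDiff_of_differentiable_iteratedDeriv fun k _ => ?_
    rw [hiter]
    exact fun t => (hg k t).differentiableAt
  have htaylor := (taylor_isLittleO_univ (x₀ := x) hsmooth).isBigO
  have htend : Tendsto (fun h : ℝ => x - h) (nhds 0) (nhds x) := by
    simpa using (continuous_sub_left x).tendsto 0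
  have hmain := htaylor.comp_tendsto htend
  have hpow : (fun h : ℝ => (x - h - x) ^ 5) =O[nhds 0] fun h : ℝ => h ^ 5 :=
    IsBigO.of_bound 1 (Eventually.of_forall fun h => by simp)
  have hfive : (fun h : ℝ => (h ^ 5) • ((1 / 120 : ℝ) • g 5 x)) =O[nhds 0] fun h : ℝ => h ^ 5 := by
    simpa using (isBigO_refl (fun h : ℝ => h ^ 5) (nhds 0)).smul
      (isBigO_const_const ((1 / 120 : ℝ) • g 5 x) (one_ne_zero (α := ℝ)) (nhds 0))
  refine ((hmain.trans hpow).sub hfive).congr_left fun h => ?_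
  simp only [Function.comp_apply, taylor_within_apply, Finset.sum_range_succ,
    Finset.sum_range_zero, iteratedDerivWithin_univ, hiter, Nat.factorial]
  push_cast
  module

end Calculus

section Transport

variable {n m : ℕ} {v : ℝ → Matrix (Fin n) (Fin m) ℂ}

theorem contDiff_Dop (hv : ContDiff ℝ (⊤ : ℕ∞) v) {w : ℝ → Fin n → ℂ}
    (hw : ContDiff ℝ (⊤ : ℕ∞) w) : ContDiff ℝ (⊤ : ℕ∞) (Dop v w) :=
  hv.matrix_mul_conjTranspose_mulVec (contDiff_infty_iff_deriv.1 hw).2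

theorem projection_mulVec_Dop (horth : ∀ t, (v t)ᴴ * v t = 1) (w : ℝ → Fin n → ℂ) (t : ℝ) :
    (v t * (v t)ᴴ) *ᵥ Dop v w t = Dop v w t := by
  rw [Dop, Matrix.mulVec_mulVec, Matrix.mul_assoc, ← Matrix.mul_assoc (v t)ᴴ, horth,
    Matrix.one_mul]

variable {P : ℝ → Matrix (Fin m) (Fin m) ℂ}

theorem conjTranspose_mul_self_of_hasDerivAt (hv : Differentiable ℝ v)
    (horth : ∀ t, (v t)ᴴ * v t = 1)
    (hP : ∀ t, HasDerivAt P (-((v t)ᴴ * deriv v t) * P t) t)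
    {x₀ : ℝ} (hP₀ : P x₀ = 1) (t : ℝ) : (P t)ᴴ * P t = 1 := by
  have hskew : ∀ s, (deriv v s)ᴴ * v s = -((v s)ᴴ * deriv v s) := fun s => by
    have h := (hv s).hasDerivAt.matrix_conjTranspose.matrix_mul (hv s).hasDerivAt
    simp only [horth] at h
    exact eq_neg_of_add_eq_zero_left (h.unique (hasDerivAt_const s _))
  have hderiv : ∀ s, HasDerivAt (fun r => (P r)ᴴ * P r) 0 s := fun s => by
    refine ((hP s).matrix_conjTranspose.matrix_mul (hP s)).congr_deriv ?_
    rw [Matrix.conjTranspose_mul, Matrix.conjTranspose_neg, Matrix.conjTranspose_mul,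
      Matrix.conjTranspose_conjTranspose, hskew, neg_neg, Matrix.mul_assoc, Matrix.neg_mul,
      Matrix.mul_neg, add_neg_cancel]
  have hconst := is_const_of_deriv_eq_zero (fun s => (hderiv s).differentiableAt)
    (fun s => (hderiv s).deriv) t x₀
  simpa [hP₀] using hconst

/-- In the parallel frame, differentiating a section amounts to applying `Dop v`. -/
theorem hasDerivAt_parallel_coordinates (hv : Differentiable ℝ v)
    (horth : ∀ t, (v t)ᴴ * v t = 1)
    (hP : ∀ t, HasDerivAt P (-((v t)ᴴ * deriv v t) * P t) t)
    {w : ℝ → Fin n → ℂ} (hw : Differentiable ℝ w)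
    (hsec : ∀ t, (v t * (v t)ᴴ) *ᵥ w t = w t) (t : ℝ) :
    HasDerivAt (fun s => ((P s)ᴴ * (v s)ᴴ) *ᵥ w s) (((P t)ᴴ * (v t)ᴴ) *ᵥ Dop v w t) t := by
  have hvt : HasDerivAt v (deriv v t) t := (hv t).hasDerivAt
  refine (((hP t).matrix_conjTranspose.matrix_mul
    hvt.matrix_conjTranspose).matrix_mulVec (hw t).hasDerivAt).congr_deriv ?_
  have hcancel : ((-((v t)ᴴ * deriv v t) * P t)ᴴ * (v t)ᴴ) *ᵥ w t
      = -(((P t)ᴴ * (deriv v t)ᴴ) *ᵥ w t) := by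
    conv_rhs => rw [← hsec t]
    rw [Matrix.mulVec_mulVec, ← Matrix.neg_mulVec]
    simp only [Matrix.conjTranspose_mul, Matrix.conjTranspose_neg,
      Matrix.conjTranspose_conjTranspose, Matrix.neg_mul, Matrix.mul_assoc]
  rw [Matrix.add_mulVec, hcancel, neg_add_cancel, zero_add, Dop, Matrix.mulVec_mulVec,
    Matrix.mul_assoc, ← Matrix.mul_assoc (v t)ᴴ, horth, Matrix.one_mul]

end Transport

/-- Expansion of the parallel transport operator `ω(h)` acting on a section `z` of the
subbundle: `v(x) Ω(x, x-h) v(x-h)ᴴ z(x-h)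
  = z - h Dz + (h²/2) D²z - (h³/6) D³z + (h⁴/24) D⁴z + O(h⁵)`. -/
theorem omega_operator_expansion {n m : ℕ}
    (v : ℝ → Matrix (Fin n) (Fin m) ℂ)
    (hv : ContDiff ℝ (⊤ : ℕ∞) v)
    (horth : ∀ x : ℝ, (v x)ᴴ * v x = 1)
    (P : ℝ → Matrix (Fin m) (Fin m) ℂ)
    (x₀ : ℝ)
    (hP : ∀ x : ℝ, HasDerivAt P (-((v x)ᴴ * deriv v x) * P x) x)
    (hP₀ : P x₀ = 1)
    (Ω : ℝ → ℝ → Matrix (Fin m) (Fin m) ℂ)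
    (hΩ : ∀ b a : ℝ, Ω b a = P b * (P a)⁻¹)
    (z : ℝ → Fin n → ℂ)
    (hz : ContDiff ℝ (⊤ : ℕ∞) z)
    (hsec : ∀ x : ℝ, (v x * (v x)ᴴ) *ᵥ z x = z x)
    (x : ℝ) :
    (fun h : ℝ =>
        v x *ᵥ (Ω x (x - h) *ᵥ ((v (x - h))ᴴ *ᵥ z (x - h)))
          - (z x - h • Dop v z x + (h ^ 2 / 2) • (Dop v)^[2] z x
              - (h ^ 3 / 6) • (Dop v)^[3] z x + (h ^ 4 / 24) • (Dop v)^[4] z x))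
      =O[nhds 0] fun h : ℝ => h ^ 5 := by
  have hvd : Differentiable ℝ v := hv.differentiable (by simp)
  have hPP := conjTranspose_mul_self_of_hasDerivAt hvd horth hP hP₀
  have hsmooth : ∀ k, ContDiff ℝ (⊤ : ℕ∞) ((Dop v)^[k] z) := fun k => by
    induction k with
    | zero => exact hz
    | succ k ih =>
      rw [Function.iterate_succ_apply']
      exact contDiff_Dop hv ih
  have hsection : ∀ k t, (v t * (v t)ᴴ) *ᵥ (Dop v)^[k] z t = (Dop v)^[k] z t := fun k t => by
    cases k with
    | zero => exact hsec t
    | succ k =>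
      rw [Function.iterate_succ_apply']
      exact projection_mulVec_Dop horth _ t
  have hderiv : ∀ k t, HasDerivAt (fun s => ((P s)ᴴ * (v s)ᴴ) *ᵥ (Dop v)^[k] z s)
      (((P t)ᴴ * (v t)ᴴ) *ᵥ (Dop v)^[k + 1] z t) t := fun k t => by
    rw [Function.iterate_succ_apply']
    exact hasDerivAt_parallel_coordinates hvd horth hP
      ((hsmooth k).differentiable (by simp)) (hsection k) t
  have hback : ∀ k, (v x * P x) *ᵥ (((P x)ᴴ * (v x)ᴴ) *ᵥ (Dop v)^[k] z x)
      = (Dop v)^[k] z x := fun k => by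
    rw [Matrix.mulVec_mulVec, Matrix.mul_assoc, ← Matrix.mul_assoc (P x),
      mul_eq_one_comm.1 (hPP x), Matrix.one_mul, hsection]
  have htaylor := isBigO_taylor_four_of_hasDerivAt
    (g := fun k s => ((P s)ᴴ * (v s)ᴴ) *ᵥ (Dop v)^[k] z s) hderiv x
  have hcont := ((Matrix.mulVecLin (v x * P x)).restrictScalars ℝ).toContinuousLinearMap
    |>.isBigO_comp _ (nhds 0) |>.trans htaylor
  refine hcont.congr_left fun h => ?_
  have hinv : (P (x - h))⁻¹ = (P (x - h))ᴴ := Matrix.inv_eq_left_inv (hPP _)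
  simp only [LinearMap.coe_toContinuousLinearMap', map_add, map_sub, map_smul,
    LinearMap.restrictScalars_apply, Matrix.mulVecLin_apply, hback, hΩ, hinv]
  simp only [Function.iterate_zero, Function.iterate_one, id_eq, Matrix.mulVec_mulVec,
    Matrix.mul_assoc]
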